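/- For w in a Coxeter group W, the number of commutation classes of reduced words of w satisfies the recurrence |C(w)| = Σ_{∅ ≠ T ⊆ D_R(w), T independent} (-1)^{|T|+1} |C(wT)|, where wT denotes w multiplied by the product of all elements of T. -/

import Mathlib

def CommMove {S : Type*} (comm : S → S → Prop) (w w' : List S) : Prop :=
  ∃ (u v : List S) (a b : S), comm a b ∧ w = u ++ a :: b :: v ∧ w' = u ++ b :: a :: v

/-- The number of commutation classes of reduced words of `w`. -/
noncomputable def commClassCount {B W : Type*} [Group W] {M : CoxeterMatrix B}
    (cs : CoxeterSystem M W) (w : W) : ℕ :=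
  Nat.card (Quot (fun l l' : {l : List B // cs.IsReduced l ∧ cs.wordProd l = w} =>
    CommMove (fun a b => M a b = 2) l.1 l'.1))

open Classical in
/-- The product of an independent set of simple reflections. -/
noncomputable def indepProd {B W : Type*} [Group W] {M : CoxeterMatrix B}
    (cs : CoxeterSystem M W) (T : Finset B) : W :=
  if h : (T : Set B).Pairwise (fun a b => Commute (cs.simple a) (cs.simple b)) then
    T.noncommProd cs.simple h
  else 1

namespace CoxeterSystem
open Module

variable {B W : Type*} [Group W] {M : CoxeterMatrix B} (cs : CoxeterSystem M W)

/-- The linear form `v ↦ 2 ⟨αᵢ, v⟩` of the geometric representation. -/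
noncomputable def geometricForm (M : CoxeterMatrix B) (i : B) : Dual ℝ (B →₀ ℝ) :=
  Finsupp.linearCombination ℝ fun j => -2 * Real.cos (Real.pi / M i j)

theorem geometricForm_single (i j : B) :
    geometricForm M i (Finsupp.single j 1) = -2 * Real.cos (Real.pi / M i j) := by
  simp [geometricForm]

theorem geometricForm_single_self (i : B) :
    geometricForm M i (Finsupp.single i 1) = 2 := by
  simp [geometricForm_single]

open Polynomial.Chebyshev in
theorem eval_S_eq_zero_of_even {m k : ℕ} (hm : 3 ≤ m) (hk : m = 2 * k) :
    (S ℝ (k - 1)).eval (2 * Real.cos (2 * (Real.pi / m))) = 0 := by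
  have hm0 : (0 : ℝ) < m := by positivity
  have hm3 : (3 : ℝ) ≤ m := by exact_mod_cast hm
  have hs : Real.sin (2 * (Real.pi / m)) ≠ 0 := by
    refine (Real.sin_pos_of_pos_of_lt_pi (by positivity) ?_).ne'
    rw [← mul_div_assoc, div_lt_iff₀ hm0]
    nlinarith [Real.pi_pos]
  refine (mul_eq_zero.mp ?_).resolve_right hs
  rw [S_two_mul_real_cos]
  have : ((((k : ℤ) - 1 : ℤ) : ℝ) + 1) * (2 * (Real.pi / m)) = Real.pi := by
    have : (m : ℝ) = 2 * k := by exact_mod_cast hk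
    push_cast
    field_simp
    linarith
  rw [this, Real.sin_pi]

open Polynomial.Chebyshev in
theorem eval_S_add_eval_S_eq_zero_of_odd {m k : ℕ} (hm : 3 ≤ m) (hk : m = 2 * k + 1) :
    (S ℝ k).eval (2 * Real.cos (2 * (Real.pi / m))) +
      (S ℝ (k - 1)).eval (2 * Real.cos (2 * (Real.pi / m))) = 0 := by
  have hm0 : (0 : ℝ) < m := by positivity
  have hm3 : (3 : ℝ) ≤ m := by exact_mod_cast hm
  have hs : Real.sin (2 * (Real.pi / m)) ≠ 0 := by
    refine (Real.sin_pos_of_pos_of_lt_pi (by positivity) ?_).ne'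
    rw [← mul_div_assoc, div_lt_iff₀ hm0]
    nlinarith [Real.pi_pos]
  refine (mul_eq_zero.mp ?_).resolve_right hs
  rw [add_mul, S_two_mul_real_cos, S_two_mul_real_cos]
  have : (((k : ℤ) : ℝ) + 1) * (2 * (Real.pi / m)) =
      2 * Real.pi - (((k : ℤ) - 1 : ℤ) + 1) * (2 * (Real.pi / m)) := by
    have : (m : ℝ) = 2 * k + 1 := by exact_mod_cast hk
    push_cast
    field_simp
    linarith
  rw [this, Real.sin_two_pi_sub]
  ring

theorem isLiftable_reflection :
    M.IsLiftable fun i => reflection (geometricForm_single_self (M := M) i) := by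
  intro i j
  rcases eq_or_ne i j with rfl | hij
  · rw [M.diagonal, pow_one]
    exact mul_eq_one_iff_eq_inv.mpr (reflection_inv _).symm
  obtain hm | hm | hm : M i j = 0 ∨ M i j = 2 ∨ 3 ≤ M i j := by
    have := M.off_diagonal i j hij
    omega
  · rw [hm, pow_zero]
  all_goals
    apply LinearEquiv.toLinearMap_injective
    have hf : geometricForm M i (Finsupp.single j 1) = -2 * Real.cos (Real.pi / M i j) :=
      geometricForm_single i j
    have hg : geometricForm M j (Finsupp.single i 1) = -2 * Real.cos (Real.pi / M i j) := by
      rw [geometricForm_single, M.symmetric]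
    rw [reflection_mul_reflection_pow (t := 2 * Real.cos (2 * (Real.pi / M i j)))
      (ht := by rw [hf, hg, Real.cos_two_mul]; ring)]
  · rw [hf, hg, hm]
    ext
    simp [mul_div_cancel₀]
    ring
  · obtain ⟨k, hk | hk⟩ := Nat.even_or_odd' (M i j)
    · have h1 : ((M i j : ℤ) - 2) / 2 = k - 1 := by omega
      have h2 : ((M i j : ℤ) - 1) / 2 = k - 1 := by omega
      rw [h1, h2, eval_S_eq_zero_of_even hm hk]
      simp
    · have h1 : ((M i j : ℤ) - 2) / 2 = k - 1 := by omega
      have h2 : ((M i j : ℤ) - 1) / 2 = k := by omega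
      have h3 : ((M i j : ℤ) - 3) / 2 = k - 1 := by omega
      have h4 : (M i j : ℤ) / 2 = k := by omega
      rw [h1, h2, h3, h4, eval_S_add_eval_S_eq_zero_of_odd hm hk]
      simp

theorem simple_injective : Function.Injective cs.simple := by
  intro i j hij
  by_contra hne
  have h := congrArg (cs.lift ⟨_, isLiftable_reflection⟩) hij
  rw [cs.lift_apply_simple, cs.lift_apply_simple] at h
  have h' := DFunLike.congr_fun (LinearEquiv.congr_fun h (Finsupp.single i 1)) i
  simp [reflection_apply, geometricForm_single, hne] at h'
  norm_num at h'

open scoped Classical in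
/-- The action of a simple reflection on pairs consisting of a group element and a sign. -/
noncomputable def signedConj (i : B) : Function.End (W × ZMod 2) := fun p =>
  (cs.simple i * p.1 * cs.simple i, p.2 + if p.1 = cs.simple i then 1 else 0)

open scoped Classical in
theorem signedConj_mul_pow_apply (i j : B) (n : ℕ) (t : W) (ε : ZMod 2) :
    ((cs.signedConj i * cs.signedConj j) ^ n) (t, ε) =
      ((cs.simple i * cs.simple j) ^ n * t * ((cs.simple i * cs.simple j) ^ n)⁻¹,
        ε + ∑ k ∈ Finset.range (2 * n),
          if t = cs.simple j * (cs.simple i * cs.simple j) ^ k then 1 else 0) := by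
  induction n with
  | zero => simp; rfl
  | succ n ih =>
    have hj : ∀ k : ℕ, cs.simple j * (cs.simple i * cs.simple j) ^ k =
        ((cs.simple i * cs.simple j) ^ k)⁻¹ * cs.simple j := by
      intro k
      induction k with
      | zero => simp
      | succ k ih => rw [pow_succ, ← mul_assoc, ih, ← pow_succ, pow_succ']; simp [mul_assoc]
    rw [pow_succ']
    change cs.signedConj i (cs.signedConj j (((cs.signedConj i * cs.signedConj j) ^ n) (t, ε))) = _
    have h1 : (cs.simple i * cs.simple j) ^ n * t * ((cs.simple i * cs.simple j) ^ n)⁻¹ =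
        cs.simple j ↔ t = cs.simple j * (cs.simple i * cs.simple j) ^ (2 * n) := by
      rw [two_mul, pow_add, ← mul_assoc, hj, mul_inv_eq_iff_eq_mul, ← eq_inv_mul_iff_mul_eq,
        mul_assoc]
    have h2 : cs.simple j * ((cs.simple i * cs.simple j) ^ n * t *
        ((cs.simple i * cs.simple j) ^ n)⁻¹) * cs.simple j = cs.simple i ↔
        t = cs.simple j * (cs.simple i * cs.simple j) ^ (2 * n + 1) := by
      rw [show 2 * n + 1 = n + (1 + n) by ring, pow_add, ← mul_assoc _ (_ ^ n) (_ ^ (1 + n)), hj, pow_add,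
        pow_one, ← eq_mul_inv_iff_mul_eq, ← eq_inv_mul_iff_mul_eq, mul_inv_eq_iff_eq_mul,
        ← eq_inv_mul_iff_mul_eq]
      simp [mul_assoc]
    rw [ih]
    simp only [signedConj, h1, h2]
    rw [show 2 * (n + 1) = 2 * n + 1 + 1 by ring, Finset.sum_range_succ, Finset.sum_range_succ]
    refine Prod.ext ?_ (by simp only [add_assoc])
    simp [pow_succ', mul_assoc]

theorem isLiftable_signedConj : M.IsLiftable cs.signedConj := by
  classical
  intro i j
  funext ⟨t, ε⟩
  rw [signedConj_mul_pow_apply, cs.simple_mul_simple_pow]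
  have : ∀ k, (cs.simple i * cs.simple j) ^ (M i j + k) = (cs.simple i * cs.simple j) ^ k := by
    intro k; rw [pow_add, cs.simple_mul_simple_pow, one_mul]
  rw [two_mul, Finset.sum_range_add]
  simp only [this, CharTwo.add_self_eq_zero]
  simp
  rfl

/-- The action of a Coxeter group on pairs consisting of a group element and a sign, under which
the sign of `t` changes by the parity of the number of occurrences of `t` among the right
inversions of a word. -/
noncomputable def signedAction : W →* Function.End (W × ZMod 2) :=
  cs.lift ⟨cs.signedConj, cs.isLiftable_signedConj⟩

theorem signedAction_simple (i : B) : cs.signedAction (cs.simple i) = cs.signedConj i :=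
  cs.lift_apply_simple _ i

open scoped Classical in
theorem signedAction_wordProd (l : List B) (t : W) (ε : ZMod 2) :
    cs.signedAction (cs.wordProd l) (t, ε) =
      (cs.wordProd l * t * (cs.wordProd l)⁻¹, ε + (cs.rightInvSeq l).count t) := by
  induction l with
  | nil => simp; rfl
  | cons i l ih =>
    rw [wordProd_cons, map_mul, signedAction_simple]
    change cs.signedConj i (cs.signedAction (cs.wordProd l) (t, ε)) = _
    have h : cs.wordProd l * t * (cs.wordProd l)⁻¹ = cs.simple i ↔
        (cs.wordProd l)⁻¹ * cs.simple i * cs.wordProd l = t := by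
      constructor <;> intro h
      · simp [← h, mul_assoc]
      · simp [← h, mul_assoc]
    rw [ih, signedConj, rightInvSeq, List.count_cons]
    refine Prod.ext (by simp [mul_assoc]) ?_
    simp only [h, add_assoc, beq_iff_eq, Nat.cast_add, Nat.cast_ite, Nat.cast_one, Nat.cast_zero]

theorem signedAction_simple_snd_eq_one_iff (w : W) (i : B) :
    (cs.signedAction w (cs.simple i, 0)).2 = 1 ↔ cs.IsRightDescent w i := by
  classical
  have key : ∀ w : W, (cs.signedAction w (cs.simple i, 0)).2 = 1 → cs.IsRightDescent w i := by
    intro w h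
    obtain ⟨l, hl, rfl⟩ := cs.exists_isReduced w
    rw [signedAction_wordProd] at h
    refine (cs.isRightInversion_of_mem_rightInvSeq hl ?_).2
    by_contra hmem
    simp [List.count_eq_zero_of_not_mem hmem] at h
  refine ⟨key w, fun hw => ?_⟩
  by_contra h
  refine cs.isRightDescent_iff_not_isRightDescent_mul.mp hw (key _ ?_)
  have h0 : (cs.signedAction w (cs.simple i, 0)).2 = 0 := by
    generalize (cs.signedAction w (cs.simple i, 0)).2 = x at h
    revert x; decide
  obtain ⟨l, rfl⟩ := cs.wordProd_surjective w
  rw [map_mul, signedAction_simple]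
  change (cs.signedAction (cs.wordProd l) (cs.signedConj i (cs.simple i, 0))).2 = 1
  rw [signedAction_wordProd] at h0
  simp only [signedConj, signedAction_wordProd, cs.simple_mul_simple_cancel_right]
  simpa using h0

theorem isRightDescent_mul_simple_of_commute {w : W} {i j : B} (hij : i ≠ j)
    (h : Commute (cs.simple i) (cs.simple j)) (hj : cs.IsRightDescent w j) :
    cs.IsRightDescent (w * cs.simple i) j := by
  rw [← signedAction_simple_snd_eq_one_iff] at hj ⊢
  rw [map_mul, signedAction_simple]
  change (cs.signedAction w (cs.signedConj i (cs.simple j, 0))).2 = 1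
  have hne : cs.simple j ≠ cs.simple i := fun e => hij (cs.simple_injective e.symm)
  simpa [signedConj, hne, h.eq] using hj

end CoxeterSystem

section CommTrace

variable {S : Type*} (comm : S → S → Prop)

/-- Words up to commutation moves. -/
abbrev CommTrace : Type _ := Quot (CommMove comm)

variable {comm}

theorem CommMove.cons (i : S) {l l' : List S} (h : CommMove comm l l') :
    CommMove comm (i :: l) (i :: l') := by
  obtain ⟨u, v, a, b, hab, rfl, rfl⟩ := h
  exact ⟨i :: u, v, a, b, hab, rfl, rfl⟩

/-- Prepending a letter to a commutation class. -/
def CommTrace.cons (i : S) : CommTrace comm → CommTrace comm :=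
  Quot.map (i :: ·) fun _ _ => CommMove.cons i

variable (comm) in
open Classical in
/-- Remove the first occurrence of `i` from a word, if `i` can be moved to the front. -/
noncomputable def extractHead (i : S) : List S → Option (List S)
  | [] => none
  | a :: l =>
    if a = i then some l else if comm i a then (extractHead i l).map (a :: ·) else none

theorem CommMove.map_mk_extractHead (hsymm : ∀ a b, comm a b → comm b a)
    (hirrefl : ∀ a, ¬ comm a a) (i : S) {l l' : List S} (h : CommMove comm l l') :
    (extractHead comm i l).map (Quot.mk (CommMove comm)) =
      (extractHead comm i l').map (Quot.mk (CommMove comm)) := by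
  obtain ⟨u, v, a, b, hab, rfl, rfl⟩ := h
  induction u with
  | nil =>
    have hne : a ≠ b := fun e => hirrefl b (e ▸ hab)
    rcases eq_or_ne a i with rfl | ha
    · simp [extractHead, hne.symm, hab]
    rcases eq_or_ne b i with rfl | hb
    · simp [extractHead, hne, hsymm _ _ hab]
    by_cases ha' : comm i a <;> by_cases hb' : comm i b <;>
      simp [extractHead, ha, hb, ha', hb']
    congr 1
    funext l
    exact Quot.sound ⟨[], l, a, b, hab, rfl, rfl⟩
  | cons c u ih =>
    rcases eq_or_ne c i with rfl | hc
    · simpa [extractHead] using Quot.sound ⟨u, v, a, b, hab, rfl, rfl⟩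
    by_cases hc' : comm i c
    · have h := congrArg (Option.map (CommTrace.cons c)) ih
      rw [Option.map_map, Option.map_map] at h
      simp only [List.cons_append, extractHead, hc, hc', if_false, if_true, Option.map_map]
      exact h
    · simp [extractHead, hc, hc']

theorem mk_eq_of_extractHead_eq_some (hsymm : ∀ a b, comm a b → comm b a) {i : S}
    {l l' : List S} (h : extractHead comm i l = some l') :
    Quot.mk (CommMove comm) l = Quot.mk (CommMove comm) (i :: l') := by
  induction l generalizing l' with
  | nil => simp [extractHead] at h
  | cons a l ih =>
    rw [extractHead] at h
    split_ifs at h with ha ha'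
    · rw [ha, Option.some.inj h]
    · obtain ⟨l'', hl'', rfl⟩ := Option.map_eq_some_iff.mp h
      exact (congrArg (CommTrace.cons a) (ih hl'')).trans
        (Quot.sound ⟨[], l'', a, i, hsymm _ _ ha', rfl, rfl⟩)

theorem CommTrace.cons_injective (hsymm : ∀ a b, comm a b → comm b a)
    (hirrefl : ∀ a, ¬ comm a a) (i : S) :
    Function.Injective (CommTrace.cons (comm := comm) i) := by
  rintro ⟨l⟩ ⟨l'⟩ h
  have := congrArg (Quot.lift (fun l => (extractHead comm i l).map (Quot.mk (CommMove comm)))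
    fun _ _ => CommMove.map_mk_extractHead hsymm hirrefl i) h
  simpa [CommTrace.cons, Quot.map, extractHead] using this

/-- The letters with which some word in a commutation class starts. -/
def CommTrace.heads (q : CommTrace comm) : Set S :=
  {i | ∃ q', CommTrace.cons i q' = q}

theorem CommTrace.mem_heads_mk (hsymm : ∀ a b, comm a b → comm b a)
    (hirrefl : ∀ a, ¬ comm a a) {i : S} {l : List S} :
    i ∈ CommTrace.heads (Quot.mk (CommMove comm) l) ↔ (extractHead comm i l).isSome := by
  constructor
  · rintro ⟨⟨l'⟩, h⟩
    have := congrArg (Quot.lift (fun l => (extractHead comm i l).map (Quot.mk (CommMove comm)))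
      fun _ _ => CommMove.map_mk_extractHead hsymm hirrefl i) h
    have := congrArg Option.isSome this
    simpa [CommTrace.cons, Quot.map, extractHead] using this.symm
  · intro h
    obtain ⟨l', h⟩ := Option.isSome_iff_exists.mp h
    exact ⟨Quot.mk _ l', (mk_eq_of_extractHead_eq_some hsymm h).symm⟩

theorem CommTrace.mem_heads_cons (hsymm : ∀ a b, comm a b → comm b a)
    (hirrefl : ∀ a, ¬ comm a a) {i j : S} (hij : comm i j) {q : CommTrace comm} :
    i ∈ (CommTrace.cons j q).heads ↔ i ∈ q.heads := by
  obtain ⟨l⟩ := q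
  have hne : j ≠ i := fun e => hirrefl i (e ▸ hij)
  change i ∈ CommTrace.heads (Quot.mk _ (j :: l)) ↔ _
  rw [mem_heads_mk hsymm hirrefl, mem_heads_mk hsymm hirrefl]
  simp [extractHead, hne, hij]

theorem CommTrace.pairwise_heads (hsymm : ∀ a b, comm a b → comm b a)
    (hirrefl : ∀ a, ¬ comm a a) (q : CommTrace comm) : q.heads.Pairwise comm := by
  obtain ⟨l⟩ := q
  intro i hi j hj hij
  rw [mem_heads_mk hsymm hirrefl] at hi hj
  induction l with
  | nil => simp [extractHead] at hi
  | cons a l ih =>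
    rw [extractHead] at hi hj
    split_ifs at hi hj <;> simp_all

end CommTrace

namespace CoxeterSystem

variable {B W : Type*} [Group W] {M : CoxeterMatrix B} (cs : CoxeterSystem M W)

theorem commute_simple_of_eq_two {i j : B} (h : M i j = 2) :
    Commute (cs.simple i) (cs.simple j) := by
  have := cs.simple_mul_simple_pow i j
  rw [h, pow_two, mul_eq_one_iff_eq_inv] at this
  rw [mul_inv_rev, inv_simple, inv_simple] at this
  exact this

/-- `l` is the reverse of a reduced word of `w`. -/
def IsReversedReducedWord (w : W) (l : List B) : Prop :=
  cs.wordProd l.reverse = w ∧ cs.length w = l.length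

variable {cs}

theorem isReversedReducedWord_congr {w : W} {l l' : List B}
    (h : CommMove (fun a b => M a b = 2) l l') :
    cs.IsReversedReducedWord w l = cs.IsReversedReducedWord w l' := by
  obtain ⟨u, v, a, b, hab, rfl, rfl⟩ := h
  have h : cs.wordProd (u ++ a :: b :: v) = cs.wordProd (u ++ b :: a :: v) := by
    simp only [wordProd_append, wordProd_cons]
    rw [(cs.commute_simple_of_eq_two hab).left_comm]
  simp [IsReversedReducedWord, wordProd_reverse, h, -List.reverse_append]

variable (cs) in
/-- The commutation classes of reversed reduced words of `w`. -/
def reducedTraces (w : W) : Set (CommTrace fun a b : B => M a b = 2) :=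
  {q | Quot.lift (cs.IsReversedReducedWord w) (fun _ _ => isReversedReducedWord_congr) q}

theorem finite_reducedTraces [Finite B] (w : W) : (cs.reducedTraces w).Finite := by
  refine ((List.finite_length_eq B (cs.length w)).image (Quot.mk _)).subset ?_
  rintro ⟨l⟩ ⟨-, hl⟩
  exact ⟨l, hl.symm, rfl⟩

theorem cons_mem_reducedTraces_iff {w : W} {i : B} {q : CommTrace fun a b : B => M a b = 2} :
    q.cons i ∈ cs.reducedTraces w ↔
      cs.IsRightDescent w i ∧ q ∈ cs.reducedTraces (w * cs.simple i) := by
  obtain ⟨l⟩ := q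
  change cs.IsReversedReducedWord w (i :: l) ↔
    _ ∧ cs.IsReversedReducedWord (w * cs.simple i) l
  have hl : cs.wordProd (i :: l).reverse = w ↔ cs.wordProd l.reverse = w * cs.simple i := by
    rw [List.reverse_cons, wordProd_append, wordProd_singleton, ← eq_mul_inv_iff_mul_eq,
      inv_simple]
  simp only [IsReversedReducedWord, hl, isRightDescent_iff, List.length_cons]
  constructor
  · rintro ⟨h, hw⟩
    have h1 := cs.length_wordProd_le l.reverse
    rw [h, List.length_reverse] at h1
    have h2 := cs.length_mul_simple w i
    exact ⟨by omega, h, by omega⟩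
  · rintro ⟨h1, h, h2⟩
    exact ⟨h, by omega⟩

theorem isRightDescent_of_mem_heads {w : W} {i : B} {q : CommTrace fun a b : B => M a b = 2}
    (hq : q ∈ cs.reducedTraces w) (hi : i ∈ q.heads) : cs.IsRightDescent w i := by
  obtain ⟨q, rfl⟩ := hi
  exact (cons_mem_reducedTraces_iff.mp hq).1

theorem heads_nonempty {w : W} (hw : w ≠ 1) {q : CommTrace fun a b : B => M a b = 2}
    (hq : q ∈ cs.reducedTraces w) : q.heads.Nonempty := by
  obtain ⟨l⟩ := q
  cases l with
  | nil => exact absurd (hq.1.symm.trans (by simp)) hw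
  | cons i l => exact ⟨i, Quot.mk _ l, rfl⟩

theorem commClassCount_eq_ncard (w : W) :
    commClassCount cs w = (cs.reducedTraces w).ncard := by
  have hgood : ∀ l : List B, cs.IsReduced l ∧ cs.wordProd l = w ↔
      cs.IsReversedReducedWord w l.reverse := by
    intro l
    simp only [IsReversedReducedWord, List.reverse_reverse, List.length_reverse]
    constructor
    · rintro ⟨h, rfl⟩; exact ⟨rfl, h⟩
    · rintro ⟨rfl, h⟩; exact ⟨h, rfl⟩
  have hrev : ∀ l l' : List B, CommMove (fun a b => M a b = 2) l l' →
      CommMove (fun a b => M a b = 2) l.reverse l'.reverse := by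
    rintro _ _ ⟨u, v, a, b, hab, rfl, rfl⟩
    exact ⟨v.reverse, u.reverse, b, a, (M.symmetric _ _).trans hab, by simp, by simp⟩
  have hmk : ∀ l l' : List B, Relation.EqvGen (CommMove fun a b => M a b = 2) l l' →
      (cs.IsReversedReducedWord w l = cs.IsReversedReducedWord w l') ∧
      ∀ (h : cs.IsReduced l.reverse ∧ cs.wordProd l.reverse = w)
        (h' : cs.IsReduced l'.reverse ∧ cs.wordProd l'.reverse = w),
        (Quot.mk (fun l l' : {l : List B // cs.IsReduced l ∧ cs.wordProd l = w} =>
          CommMove (fun a b => M a b = 2) l.1 l'.1) ⟨l.reverse, h⟩) =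
        Quot.mk _ ⟨l'.reverse, h'⟩ := by
    intro l l' hl
    induction hl with
    | rel l l' h => exact ⟨isReversedReducedWord_congr h, fun _ _ => Quot.sound (hrev _ _ h)⟩
    | refl l => exact ⟨rfl, fun _ _ => rfl⟩
    | symm l l' _ ih => exact ⟨ih.1.symm, fun h h' => (ih.2 h' h).symm⟩
    | trans l l' l'' _ _ ih ih' =>
      refine ⟨ih.1.trans ih'.1, fun h h'' => ?_⟩
      have h' : cs.IsReduced l'.reverse ∧ cs.wordProd l'.reverse = w := by
        rw [hgood, List.reverse_reverse, ← ih.1]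
        simpa using (hgood _).mp h
      exact (ih.2 h h').trans (ih'.2 h' h'')
  rw [commClassCount, ← Nat.card_coe_set_eq]
  refine Nat.card_congr (Equiv.ofBijective
    (Quot.lift (fun l => ⟨Quot.mk _ l.1.reverse, (hgood _).mp l.2⟩) fun l l' h =>
      Subtype.ext (Quot.sound (hrev _ _ h))) ⟨?_, ?_⟩)
  · rintro ⟨l, hl⟩ ⟨l', hl'⟩ h
    have h := (hmk _ _ (Quot.eqvGen_exact (congrArg Subtype.val h))).2
    simp only [List.reverse_reverse] at h
    exact h hl hl'
  · rintro ⟨⟨l⟩, hl⟩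
    refine ⟨Quot.mk _ ⟨l.reverse, (hgood _).mpr ?_⟩, ?_⟩
    · rwa [List.reverse_reverse]
    · exact Subtype.ext (congrArg (Quot.mk _) (List.reverse_reverse l))

theorem indepProd_empty : indepProd cs ∅ = 1 := by
  simp [indepProd]

theorem indepProd_insert [DecidableEq B] {i : B} {T : Finset B} (hi : i ∉ T)
    (hT : ((insert i T : Finset B) : Set B).Pairwise fun a b => M a b = 2) :
    indepProd cs (insert i T) = cs.simple i * indepProd cs T := by
  have hc : ((insert i T : Finset B) : Set B).Pairwise
      fun a b => Commute (cs.simple a) (cs.simple b) :=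
    hT.imp fun _ _ => cs.commute_simple_of_eq_two
  rw [indepProd, dif_pos hc, indepProd, dif_pos (hc.mono (by simp))]
  convert Finset.noncommProd_insert_of_notMem T i cs.simple _ hi

theorem ncard_subset_heads (T : Finset B) (w : W) (hdesc : ∀ i ∈ T, cs.IsRightDescent w i)
    (hT : (T : Set B).Pairwise fun a b => M a b = 2) :
    {q ∈ cs.reducedTraces w | (T : Set B) ⊆ q.heads}.ncard =
      commClassCount cs (w * indepProd cs T) := by
  classical
  induction T using Finset.induction_on generalizing w with
  | empty => simp [indepProd_empty, commClassCount_eq_ncard]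
  | insert i T hi ih =>
    have hsymm : ∀ a b : B, M a b = 2 → M b a = 2 := fun a b h => (M.symmetric _ _).trans h
    have hirrefl : ∀ a : B, ¬ M a a = 2 := fun a => by simp
    have hcomm : ∀ j ∈ T, M j i = 2 := fun j hj =>
      hT (by simp [hj]) (by simp) (ne_of_mem_of_not_mem hj hi)
    rw [indepProd_insert hi hT, ← mul_assoc, ← ih (w * cs.simple i) ?_ (hT.mono (by simp))]
    · refine (congrArg Set.ncard ?_).trans
        (Set.ncard_image_of_injective _ (CommTrace.cons_injective hsymm hirrefl i))
      ext q
      simp only [Finset.coe_insert, Set.insert_subset_iff, Set.mem_ofPred_eq, Set.mem_image]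
      have hheads : ∀ q : CommTrace fun a b : B => M a b = 2,
          (T : Set B) ⊆ (q.cons i).heads ↔ (T : Set B) ⊆ q.heads := fun q =>
        forall₂_congr fun j hj => CommTrace.mem_heads_cons hsymm hirrefl (hcomm j hj)
      constructor
      · rintro ⟨hq, ⟨q, rfl⟩, hqT⟩
        exact ⟨q, ⟨(cons_mem_reducedTraces_iff.mp hq).2, (hheads q).mp hqT⟩, rfl⟩
      · rintro ⟨q, ⟨hq, hqT⟩, rfl⟩
        exact ⟨cons_mem_reducedTraces_iff.mpr ⟨hdesc i (by simp), hq⟩, ⟨q, rfl⟩,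
          (hheads q).mpr hqT⟩
    · intro j hj
      exact cs.isRightDescent_mul_simple_of_commute (ne_of_mem_of_not_mem hj hi).symm
        (cs.commute_simple_of_eq_two (hcomm j hj)).symm (hdesc j (by simp [hj]))

end CoxeterSystem

open Classical in
theorem commClassCount_recurrence {B W : Type*} [Fintype B] [Group W]
    {M : CoxeterMatrix B} (cs : CoxeterSystem M W) (w : W) (hw : w ≠ 1) :
    (commClassCount cs w : ℤ) =
      ∑ T ∈ Finset.univ.filter (fun T : Finset B =>
          T.Nonempty ∧ (∀ i ∈ T, cs.IsRightDescent w i) ∧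
          (T : Set B).Pairwise (fun a b => M a b = 2)),
        (-1 : ℤ) ^ (T.card + 1) * commClassCount cs (w * indepProd cs T) := by
  have hsymm : ∀ a b : B, M a b = 2 → M b a = 2 := fun a b h => (M.symmetric _ _).trans h
  have hirrefl : ∀ a : B, ¬ M a a = 2 := fun a => by simp
  have hfin := CoxeterSystem.finite_reducedTraces (cs := cs) w
  have hcount : ∀ T ∈ Finset.univ.filter (fun T : Finset B =>
      T.Nonempty ∧ (∀ i ∈ T, cs.IsRightDescent w i) ∧
      (T : Set B).Pairwise (fun a b => M a b = 2)),
      (-1 : ℤ) ^ (T.card + 1) * commClassCount cs (w * indepProd cs T) =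
        ∑ q ∈ hfin.toFinset with (T : Set B) ⊆ q.heads, (-1 : ℤ) ^ (T.card + 1) := by
    intro T hT
    obtain ⟨-, hdesc, hT⟩ := (Finset.mem_filter.mp hT).2
    have hcard : {q ∈ cs.reducedTraces w | (T : Set B) ⊆ q.heads}.ncard =
        (hfin.toFinset.filter fun q => (T : Set B) ⊆ q.heads).card := by
      rw [← Set.ncard_coe_finset]
      congr 1
      ext q
      simp
    rw [← CoxeterSystem.ncard_subset_heads T w hdesc hT, Finset.sum_const, nsmul_eq_mul, mul_comm,
      hcard]
  rw [Finset.sum_congr rfl hcount,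
    Finset.sum_comm' (t' := hfin.toFinset)
      (s' := fun q => q.heads.toFinset.powerset.erase ∅) ?_]
  · have hone : ∀ q ∈ hfin.toFinset,
        ∑ T ∈ q.heads.toFinset.powerset.erase ∅, (-1 : ℤ) ^ (T.card + 1) = 1 := by
      intro q hq
      have hne : q.heads.toFinset.Nonempty := by
        simpa using CoxeterSystem.heads_nonempty hw (hfin.mem_toFinset.mp hq)
      have h := Finset.sum_powerset_neg_one_pow_card_of_nonempty hne
      rw [← Finset.add_sum_erase _ _ (Finset.empty_mem_powerset _), Finset.card_empty,
        pow_zero] at h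
      simp only [pow_succ, mul_neg, mul_one, Finset.sum_neg_distrib]
      linarith
    rw [Finset.sum_congr rfl hone, CoxeterSystem.commClassCount_eq_ncard,
      Set.ncard_eq_toFinset_card _ hfin]
    simp
  · intro T q
    simp only [Finset.mem_filter, Finset.mem_univ, true_and, Set.Finite.mem_toFinset,
      Finset.mem_erase, Finset.mem_powerset, Finset.nonempty_iff_ne_empty,
      Finset.subset_iff, Set.mem_toFinset]
    constructor
    · rintro ⟨⟨hne, -, -⟩, hq, hT⟩
      exact ⟨⟨hne, fun _ hi => hT hi⟩, hq⟩
    · rintro ⟨⟨hne, hT⟩, hq⟩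
      exact ⟨⟨hne, fun i hi => CoxeterSystem.isRightDescent_of_mem_heads hq (hT hi),
        (q.pairwise_heads hsymm hirrefl).mono fun _ hi => hT hi⟩, hq, fun _ hi => hT hi⟩
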